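/- With the setup of the local well-posedness theorem (initial vorticity ω₀ ∈ W^{1,1}(ℝ²), ‖ω₀‖_{W^{1,1}} ≤ A₀, t₀ = C/A₀², and ω the mild solution on (0,t₀]): for every p with 1 ≤ p ≤ 2 there is a constant C_p (depending only on p and A₀) such that sup_{0<t≤t₀} ‖ω(·,t)‖_{L^p(ℝ²)} ≤ C_p. -/

import Mathlib

open MeasureTheory Real Filter
open scoped ENNReal RealInnerProductSpace Topology

noncomputable section

abbrev E2 := EuclideanSpace ℝ (Fin 2)

/-- The two-dimensional heat kernel. -/
def K (t : ℝ) (x : E2) : ℝ := (4 * π * t)⁻¹ * Real.exp (-‖x‖ ^ 2 / (4 * t))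

/-- Rotation by 90 degrees: `z^⊥ = (−z₂, z₁)`. -/
def perp (z : E2) : E2 := (EuclideanSpace.equiv (Fin 2) ℝ).symm ![-(z 1), z 0]

/-- The Biot–Savart velocity of a scalar vorticity on `ℝ²`:
`v(x) = (1/2π) ∫ (x−y)^⊥ / |x−y|² · ω(y) dy`. -/
def biotSavart (ω : E2 → ℝ) (x : E2) : E2 :=
  (2 * π)⁻¹ • ∫ y : E2, (ω y / ‖x - y‖ ^ 2) • perp (x - y)

/-- Membership in `W^{1,1}(ℝ²)` (strong form). -/
def MemW11 (f : E2 → ℝ) : Prop :=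
  Integrable f volume ∧ Differentiable ℝ f ∧ Integrable (fun x => gradient f x) volume

/-- The `W^{1,1}(ℝ²)` norm `‖f‖_{L¹} + ‖∇f‖_{L¹}`, valued in `ℝ≥0∞`. -/
def W11 (f : E2 → ℝ) : ℝ≥0∞ :=
  eLpNorm f 1 volume + eLpNorm (fun x => gradient f x) 1 volume

/-- `ω` is a mild (Duhamel) solution of the 2D vorticity equation on `(0, t₀]`
with initial vorticity `ω₀`. -/
def IsMildSolution (ω₀ : E2 → ℝ) (t₀ : ℝ) (ω : ℝ → E2 → ℝ) : Prop :=
  ∀ t ∈ Set.Ioc (0 : ℝ) t₀, ∀ x : E2,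
    ω t x = (∫ y : E2, K t (x - y) * ω₀ y) +
      ∫ s in Set.Ioc (0 : ℝ) t,
        ∫ y : E2, ⟪gradient (K (t - s)) (x - y), ω s y • biotSavart (ω s) y⟫


/-- A function on the line which is integrable together with its derivative is bounded by the
`L¹` norm of the derivative. -/
theorem enorm_le_lintegral_enorm_of_hasDerivAt {u u' : ℝ → ℝ} (hu : ∀ x, HasDerivAt u (u' x) x)
    (hui : Integrable u) (hui' : Integrable u') (x : ℝ) :
    ‖u x‖ₑ ≤ ∫⁻ s, ‖u' s‖ₑ := by
  have hlim : Tendsto u atBot (𝓝 0) :=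
    tendsto_zero_of_hasDerivAt_of_integrableOn_Iic (a := x) (fun y _ => hu y)
      hui'.integrableOn hui.integrableOn
  have hftc := integral_Iic_of_hasDerivAt_of_tendsto' (a := x) (fun y _ => hu y)
    hui'.integrableOn hlim
  rw [sub_zero] at hftc
  rw [← hftc]
  exact (enorm_integral_le_lintegral_enorm _).trans (setLIntegral_le_lintegral _ _)

/-- The `L²` form of the Gagliardo–Nirenberg inequality on `ℝ × ℝ`. -/
theorem lintegral_enorm_sq_le_of_hasDerivAt {g g₁ g₂ : ℝ × ℝ → ℝ}
    (h₁ : ∀ a b, HasDerivAt (fun s => g (s, b)) (g₁ (a, b)) a)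
    (h₂ : ∀ a b, HasDerivAt (fun s => g (a, s)) (g₂ (a, b)) b)
    (hg : Integrable g) (hg₁ : Integrable g₁) (hg₂ : Integrable g₂) :
    ∫⁻ z, ‖g z‖ₑ ^ 2 ≤ (∫⁻ z, ‖g₁ z‖ₑ) * ∫⁻ z, ‖g₂ z‖ₑ := by
  have hm₁ : AEMeasurable (fun z => ‖g₁ z‖ₑ) (volume.prod volume) :=
    hg₁.aestronglyMeasurable.enorm
  have hm₂ : AEMeasurable (fun z => ‖g₂ z‖ₑ) (volume.prod volume) :=
    hg₂.aestronglyMeasurable.enorm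
  have hrow : ∀ᵐ b : ℝ, ∀ a : ℝ, ‖g (a, b)‖ₑ ≤ ∫⁻ s, ‖g₁ (s, b)‖ₑ := by
    filter_upwards [hg.prod_left_ae, hg₁.prod_left_ae] with b hb hb₁ a
    exact enorm_le_lintegral_enorm_of_hasDerivAt (fun s => h₁ s b) hb hb₁ a
  have hcol : ∀ᵐ a : ℝ, ∀ b : ℝ, ‖g (a, b)‖ₑ ≤ ∫⁻ s, ‖g₂ (a, s)‖ₑ := by
    filter_upwards [hg.prod_right_ae, hg₂.prod_right_ae] with a ha ha₂ b
    exact enorm_le_lintegral_enorm_of_hasDerivAt (fun s => h₂ a s) ha ha₂ b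
  have hbound : ∀ᵐ z : ℝ × ℝ, ‖g z‖ₑ ^ 2 ≤
      (∫⁻ s, ‖g₂ (z.1, s)‖ₑ) * ∫⁻ s, ‖g₁ (s, z.2)‖ₑ := by
    filter_upwards [Measure.quasiMeasurePreserving_fst.ae hcol,
      Measure.quasiMeasurePreserving_snd.ae hrow] with z hz₂ hz₁
    rw [sq]
    exact mul_le_mul' (hz₂ z.2) (hz₁ z.1)
  calc ∫⁻ z, ‖g z‖ₑ ^ 2
      ≤ ∫⁻ z : ℝ × ℝ, (∫⁻ s, ‖g₂ (z.1, s)‖ₑ) * ∫⁻ s, ‖g₁ (s, z.2)‖ₑ := lintegral_mono_ae hbound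
    _ = (∫⁻ a, ∫⁻ s, ‖g₂ (a, s)‖ₑ) * ∫⁻ b, ∫⁻ s, ‖g₁ (s, b)‖ₑ :=
        lintegral_prod_mul hm₂.lintegral_prod_right' hm₁.lintegral_prod_left'
    _ = (∫⁻ z, ‖g₁ z‖ₑ) * ∫⁻ z, ‖g₂ z‖ₑ := by
        rw [mul_comm, Measure.volume_eq_prod, lintegral_prod_symm _ hm₁, lintegral_prod _ hm₂]

/-- The identification of `ℝ × ℝ` with the Euclidean plane. -/
def planeEquiv : (ℝ × ℝ) ≃ᵐ E2 :=
  MeasurableEquiv.finTwoArrow.symm.trans (MeasurableEquiv.toLp 2 (Fin 2 → ℝ))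

theorem measurePreserving_planeEquiv : MeasurePreserving planeEquiv :=
  (volume_preserving_finTwoArrow ℝ).symm.trans
    (EuclideanSpace.volume_preserving_symm_measurableEquiv_toLp (Fin 2)).symm

/-- The derivative of a differentiable function along a line is the inner product of its gradient
with the direction. -/
theorem hasDerivAt_comp_line {f : E2 → ℝ} (hf : Differentiable ℝ f) {γ : ℝ → E2} {e : E2} {s : ℝ}
    (hγ : HasDerivAt γ e s) : HasDerivAt (fun s => f (γ s)) ⟪gradient f (γ s), e⟫ s := by
  have h := (hf (γ s)).hasGradientAt.hasFDerivAt.comp_hasDerivAt s hγ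
  simpa [Function.comp_def] using h

/-- The Gagliardo–Nirenberg inequality `‖f‖_{L²} ≤ ‖∇f‖_{L¹}` on the plane. -/
theorem lintegral_enorm_sq_le_lintegral_enorm_gradient_sq {f : E2 → ℝ} (hf : MemW11 f) :
    ∫⁻ x, ‖f x‖ₑ ^ 2 ≤ (∫⁻ x, ‖gradient f x‖ₑ) ^ 2 := by
  obtain ⟨hfi, hfd, hfg⟩ := hf
  have hψ := measurePreserving_planeEquiv
  have hψe := planeEquiv.measurableEmbedding
  have hpartial (i : Fin 2) : Integrable
      fun z => ⟪gradient f (planeEquiv z), EuclideanSpace.single i (1 : ℝ)⟫ :=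
    ((hψ.integrable_comp_emb hψe).2 hfg).inner_const _
  have hpartial_le (i : Fin 2) :
      ∫⁻ z, ‖⟪gradient f (planeEquiv z), EuclideanSpace.single i (1 : ℝ)⟫‖ₑ
        ≤ ∫⁻ x, ‖gradient f x‖ₑ := by
    rw [← hψ.lintegral_comp_emb hψe]
    refine lintegral_mono fun z => ?_
    rw [enorm_le_iff_norm_le]
    simpa using norm_inner_le_norm (𝕜 := ℝ) (gradient f (planeEquiv z))
      (EuclideanSpace.single i (1 : ℝ))
  have hline₁ (a b : ℝ) : HasDerivAt (fun s => planeEquiv (s, b))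
      (EuclideanSpace.single 0 (1 : ℝ)) a := by
    refine (PiLp.hasFDerivAt_toLp (𝕜 := ℝ) 2 ![a, b]).comp_hasDerivAt_of_eq a
      (f := fun s => ![s, b]) (f' := Pi.single 0 1) (hasDerivAt_pi.2 fun i => ?_) rfl
    fin_cases i
    · simpa using hasDerivAt_id' a
    · simpa using hasDerivAt_const a b
  have hline₂ (a b : ℝ) : HasDerivAt (fun s => planeEquiv (a, s))
      (EuclideanSpace.single 1 (1 : ℝ)) b := by
    refine (PiLp.hasFDerivAt_toLp (𝕜 := ℝ) 2 ![a, b]).comp_hasDerivAt_of_eq b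
      (f := fun s => ![a, s]) (f' := Pi.single 1 1) (hasDerivAt_pi.2 fun i => ?_) rfl
    fin_cases i
    · simpa using hasDerivAt_const b a
    · simpa using hasDerivAt_id' b
  rw [← hψ.lintegral_comp_emb hψe, sq]
  exact (lintegral_enorm_sq_le_of_hasDerivAt (g := fun z => f (planeEquiv z))
    (fun a b => hasDerivAt_comp_line hfd (hline₁ a b))
    (fun a b => hasDerivAt_comp_line hfd (hline₂ a b))
    ((hψ.integrable_comp_emb hψe).2 hfi) (hpartial 0) (hpartial 1)).trans
    (mul_le_mul' (hpartial_le 0) (hpartial_le 1))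

theorem ENNReal.rpow_le_add_sq {p : ℝ} (hp₁ : 1 ≤ p) (hp₂ : p ≤ 2) (a : ℝ≥0∞) :
    a ^ p ≤ a + a ^ 2 := by
  rcases le_total a 1 with h | h
  · refine le_add_right ?_
    simpa using ENNReal.rpow_le_rpow_of_exponent_ge h hp₁
  · refine le_add_left ?_
    simpa using ENNReal.rpow_le_rpow_of_exponent_le h hp₂

/-- Every `L^p` norm with `1 ≤ p ≤ 2` is controlled by the `W^{1,1}` norm. -/
theorem eLpNorm_le_of_W11_le {p : ℝ} (hp₁ : 1 ≤ p) (hp₂ : p ≤ 2) {f : E2 → ℝ} (hf : MemW11 f)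
    {B : ℝ≥0∞} (hB : W11 f ≤ B) :
    eLpNorm f (ENNReal.ofReal p) volume ≤ 1 + B + B ^ 2 := by
  have hp : 0 < p := zero_lt_one.trans_le hp₁
  simp only [W11, eLpNorm_one_eq_lintegral_enorm] at hB
  have hsq := lintegral_enorm_sq_le_lintegral_enorm_gradient_sq hf
  have hint : ∫⁻ x, ‖f x‖ₑ ^ p ≤ 1 + B + B ^ 2 := calc
    ∫⁻ x, ‖f x‖ₑ ^ p ≤ ∫⁻ x, (‖f x‖ₑ + ‖f x‖ₑ ^ 2) :=
        lintegral_mono fun x => ENNReal.rpow_le_add_sq hp₁ hp₂ _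
    _ = (∫⁻ x, ‖f x‖ₑ) + ∫⁻ x, ‖f x‖ₑ ^ 2 :=
        lintegral_add_left' hf.1.aestronglyMeasurable.enorm _
    _ ≤ B + B ^ 2 := by
        gcongr
        · exact (le_add_right le_rfl).trans hB
        · exact hsq.trans (by gcongr; exact (le_add_left le_rfl).trans hB)
    _ ≤ 1 + B + B ^ 2 := by
        rw [add_assoc]
        exact le_add_left le_rfl
  rw [eLpNorm_eq_lintegral_rpow_enorm_toReal (by simpa using hp) ENNReal.ofReal_ne_top,
    ENNReal.toReal_ofReal hp.le]
  calc (∫⁻ x, ‖f x‖ₑ ^ p) ^ (1 / p) ≤ (1 + B + B ^ 2) ^ (1 / p) := by gcongr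
    _ ≤ (1 + B + B ^ 2) ^ (1 : ℝ) := by
        refine ENNReal.rpow_le_rpow_of_exponent_le ?_ ((div_le_one hp).2 hp₁)
        rw [add_assoc]
        exact le_add_right le_rfl
    _ = 1 + B + B ^ 2 := ENNReal.rpow_one _

/-- **Uniform `L^p` bounds on the vorticity, `1 ≤ p ≤ 2` (corollary to
Theorem 1).** With the constants `C, c` of the local well-posedness theorem:
for every `1 ≤ p ≤ 2` and every `A₀ > 0` there is a constant `C_p` (depending
only on `p` and `A₀`) such that any mild solution `ω` on `(0, t₀]`,
`t₀ = C/A₀²`, with initial data of `W^{1,1}`-norm at most `A₀` and satisfying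
the a priori bound `sup_{0<t≤t₀} ‖ω(·,t)‖_{W^{1,1}} ≤ c A₀`, satisfies
`sup_{0<t≤t₀} ‖ω(·,t)‖_{L^p(ℝ²)} ≤ C_p`. -/
theorem vorticity_uniform_Lp_bounds :
    ∃ C : ℝ, 0 < C ∧ ∃ c : ℝ, 0 < c ∧
      ∀ p : ℝ, 1 ≤ p → p ≤ 2 →
      ∀ (A₀ : ℝ), 0 < A₀ →
        ∃ Cp : ℝ, 0 < Cp ∧
          ∀ ω₀ : E2 → ℝ, MemW11 ω₀ → W11 ω₀ ≤ ENNReal.ofReal A₀ →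
          ∀ ω : ℝ → E2 → ℝ,
            (∀ t ∈ Set.Ioc (0 : ℝ) (C / A₀ ^ 2),
              MemW11 (ω t) ∧ W11 (ω t) ≤ ENNReal.ofReal (c * A₀)) →
            IsMildSolution ω₀ (C / A₀ ^ 2) ω →
            (⨆ t ∈ Set.Ioc (0 : ℝ) (C / A₀ ^ 2),
              eLpNorm (ω t) (ENNReal.ofReal p) volume) ≤ ENNReal.ofReal Cp := by
  refine ⟨1, one_pos, 1, one_pos, fun p hp₁ hp₂ A₀ hA₀ =>
    ⟨1 + A₀ + A₀ ^ 2, by positivity, fun ω₀ _ _ ω hω _ => iSup₂_le fun t ht => ?_⟩⟩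
  obtain ⟨hmem, hle⟩ := hω t ht
  rw [one_mul] at hle
  refine (eLpNorm_le_of_W11_le hp₁ hp₂ hmem hle).trans_eq ?_
  rw [ENNReal.ofReal_add (by positivity) (by positivity),
    ENNReal.ofReal_add zero_le_one hA₀.le, ENNReal.ofReal_one, ENNReal.ofReal_pow hA₀.le]

end
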